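/- Let (A,≺,≻) be a finite-dimensional pre-anti-flexible algebra over a field F of characteristic 0 and let r ∈ A⊗A be a symmetric solution of the pre-anti-flexible Yang–Baxter equation r23·r12 = r12≺r13 + r13≻r23, with induced linear map r : A* → A. Then the products a ≺' b := L*≻(r(b))a and a ≻' b := R*≺(r(a))b make the dual space A* a pre-anti-flexible algebra. -/

import Mathlib

open TensorProduct

/-- Pre-anti-flexible algebra structure on a pair of bilinear products `(≺, ≻) = (p, s)`. -/
def IsPreAntiFlexible {F A : Type*} [Field F] [AddCommGroup A] [Module F A]
    (p s : A →ₗ[F] A →ₗ[F] A) : Prop :=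
  (∀ x y z : A, p (s x y) z - s x (p y z) = p (s z y) x - s z (p y x)) ∧
  (∀ x y z : A, s (p x y + s x y) z - s x (s y z) = p (p z y) x - p z (p y x + s y x))

/-- The linear map sending `(x⊗y)⊗(z⊗w)` to `z ⊗ (m x w) ⊗ y`; applied to `r ⊗ r` it
yields `r23·r12 = Σ_{i,j} a_j ⊗ (a_i · b_j) ⊗ b_i`. -/
noncomputable def yb1 {F A : Type*} [Field F] [AddCommGroup A] [Module F A]
    (m : A →ₗ[F] A →ₗ[F] A) :
    ((A ⊗[F] A) ⊗[F] (A ⊗[F] A)) →ₗ[F] A ⊗[F] (A ⊗[F] A) :=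
  (TensorProduct.map LinearMap.id
      (TensorProduct.map (TensorProduct.lift m) LinearMap.id))
    ∘ₗ (TensorProduct.map LinearMap.id (TensorProduct.assoc F A A A).symm.toLinearMap)
    ∘ₗ (TensorProduct.assoc F A A (A ⊗[F] A)).toLinearMap
    ∘ₗ (TensorProduct.tensorTensorTensorComm F A A A A).toLinearMap
    ∘ₗ (TensorProduct.comm F (A ⊗[F] A) (A ⊗[F] A)).toLinearMap

/-- The linear map sending `(x⊗y)⊗(z⊗w)` to `(p x z) ⊗ y ⊗ w`; applied to `r ⊗ r` it
yields `r12 ≺ r13 = Σ_{i,j} (a_i ≺ a_j) ⊗ b_i ⊗ b_j`. -/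
noncomputable def yb2 {F A : Type*} [Field F] [AddCommGroup A] [Module F A]
    (p : A →ₗ[F] A →ₗ[F] A) :
    ((A ⊗[F] A) ⊗[F] (A ⊗[F] A)) →ₗ[F] A ⊗[F] (A ⊗[F] A) :=
  (TensorProduct.map (TensorProduct.lift p) LinearMap.id)
    ∘ₗ (TensorProduct.tensorTensorTensorComm F A A A A).toLinearMap

/-- The linear map sending `(x⊗y)⊗(z⊗w)` to `x ⊗ z ⊗ (s y w)`; applied to `r ⊗ r` it
yields `r13 ≻ r23 = Σ_{i,j} a_i ⊗ a_j ⊗ (b_i ≻ b_j)`. -/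
noncomputable def yb3 {F A : Type*} [Field F] [AddCommGroup A] [Module F A]
    (s : A →ₗ[F] A →ₗ[F] A) :
    ((A ⊗[F] A) ⊗[F] (A ⊗[F] A)) →ₗ[F] A ⊗[F] (A ⊗[F] A) :=
  (TensorProduct.assoc F A A A).toLinearMap
    ∘ₗ (TensorProduct.map LinearMap.id (TensorProduct.lift s))
    ∘ₗ (TensorProduct.tensorTensorTensorComm F A A A A).toLinearMap

/-- The pre-anti-flexible Yang–Baxter equation `r23·r12 = r12 ≺ r13 + r13 ≻ r23` for
`r ∈ A ⊗ A`, with product `x·y = p x y + s x y`. -/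
noncomputable def IsPAFYBESolution {F A : Type*} [Field F] [AddCommGroup A] [Module F A]
    (p s : A →ₗ[F] A →ₗ[F] A) (r : A ⊗[F] A) : Prop :=
  yb1 (p + s) (r ⊗ₜ[F] r) = yb2 p (r ⊗ₜ[F] r) + yb3 s (r ⊗ₜ[F] r)

/-- A tensor `r ∈ A ⊗ A` as a linear map `A* → A`, `⟨r(a), b⟩ = ⟨r, a ⊗ b⟩`. -/
noncomputable def rMapL {F A : Type*} [Field F] [AddCommGroup A] [Module F A] :
    (A ⊗[F] A) →ₗ[F] (Module.Dual F A →ₗ[F] A) :=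
  (dualTensorHom F (Module.Dual F A) A)
    ∘ₗ (TensorProduct.map (Module.Dual.eval F A) LinearMap.id)

section PairingFormulas

variable {F A : Type*} [Field F] [AddCommGroup A] [Module F A]

theorem rMapL_tmul (x y : A) (a : Module.Dual F A) : rMapL (x ⊗ₜ[F] y) a = a x • y := by
  simp [rMapL]

theorem apply_rMapL_comm (t : A ⊗[F] A) (a b : Module.Dual F A) :
    a (rMapL (TensorProduct.comm F A A t) b) = b (rMapL t a) := by
  induction t with
  | zero => simp
  | tmul x y => simp [rMapL_tmul, mul_comm]
  | add t u ht hu => simp [ht, hu]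

/-- The functional `a ⊗ b ⊗ c` on `A ⊗ A ⊗ A`. -/
noncomputable def tripleDual (a b c : Module.Dual F A) : Module.Dual F (A ⊗[F] (A ⊗[F] A)) :=
  TensorProduct.dualDistrib F A (A ⊗[F] A) (a ⊗ₜ TensorProduct.dualDistrib F A A (b ⊗ₜ c))

theorem tripleDual_yb1 (m : A →ₗ[F] A →ₗ[F] A) (a b c : Module.Dual F A) (t u : A ⊗[F] A) :
    tripleDual a b c (yb1 m (t ⊗ₜ u)) =
      b (m (rMapL (TensorProduct.comm F A A t) c) (rMapL u a)) := by
  induction t with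
  | zero => simp
  | add t t' ht ht' => simp [TensorProduct.add_tmul, ht, ht']
  | tmul x y =>
    induction u with
    | zero => simp
    | add u u' hu hu' => simp only [TensorProduct.tmul_add, map_add, LinearMap.add_apply, hu, hu']
    | tmul z w => simp [tripleDual, yb1, rMapL_tmul, mul_comm]

theorem tripleDual_yb2 (p : A →ₗ[F] A →ₗ[F] A) (a b c : Module.Dual F A) (t u : A ⊗[F] A) :
    tripleDual a b c (yb2 p (t ⊗ₜ u)) =
      a (p (rMapL (TensorProduct.comm F A A t) b) (rMapL (TensorProduct.comm F A A u) c)) := by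
  induction t with
  | zero => simp
  | add t t' ht ht' => simp [TensorProduct.add_tmul, ht, ht']
  | tmul x y =>
    induction u with
    | zero => simp
    | add u u' hu hu' => simp only [TensorProduct.tmul_add, map_add, LinearMap.add_apply, hu, hu']
    | tmul z w => simp [tripleDual, yb2, rMapL_tmul, mul_comm, mul_assoc, mul_left_comm]

theorem tripleDual_yb3 (s : A →ₗ[F] A →ₗ[F] A) (a b c : Module.Dual F A) (t u : A ⊗[F] A) :
    tripleDual a b c (yb3 s (t ⊗ₜ u)) = c (s (rMapL t a) (rMapL u b)) := by
  induction t with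
  | zero => simp
  | add t t' ht ht' => simp [TensorProduct.add_tmul, ht, ht']
  | tmul x y =>
    induction u with
    | zero => simp
    | add u u' hu hu' => simp only [TensorProduct.tmul_add, map_add, LinearMap.add_apply, hu, hu']
    | tmul z w => simp [tripleDual, yb3, rMapL_tmul, mul_left_comm]

/-- A symmetric solution of the pre-anti-flexible Yang–Baxter equation intertwines the sum of the
two dual products with the sum of the two products of `A`. -/
theorem rMapL_dual_mul_of_symm_PAFYBE {p s : A →ₗ[F] A →ₗ[F] A} {r : A ⊗[F] A}
    (hsymm : TensorProduct.comm F A A r = r) (hybe : IsPAFYBESolution p s r)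
    (a b : Module.Dual F A) :
    rMapL r (Module.Dual.transpose (R := F) (s (rMapL r b)) a +
        Module.Dual.transpose (R := F) (p.flip (rMapL r a)) b) =
      p (rMapL r a) (rMapL r b) + s (rMapL r a) (rMapL r b) := by
  refine sub_eq_zero.mp ((Module.forall_dual_apply_eq_zero_iff F _).mp fun c => ?_)
  have h := congrArg (tripleDual b c a) hybe
  rw [map_add, tripleDual_yb1, tripleDual_yb2, tripleDual_yb3, hsymm] at h
  rw [map_sub, sub_eq_zero, ← apply_rMapL_comm, hsymm]
  simp only [LinearMap.add_apply, map_add] at h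
  simp only [LinearMap.add_apply, Module.Dual.transpose_apply, LinearMap.comp_apply,
    LinearMap.flip_apply, map_add]
  rw [h, add_comm]

end PairingFormulas

/-- for a symmetric solution `r` of PAFYBE, the products
`a ≺' b = L*≻(r(b))a` and `a ≻' b = R*≺(r(a))b` make `A*` a pre-anti-flexible algebra. -/
theorem dual_products_preAntiFlexible_of_symm_PAFYBE
    {F A : Type*} [Field F] [CharZero F] [AddCommGroup A] [Module F A]
    [FiniteDimensional F A]
    (p s : A →ₗ[F] A →ₗ[F] A) (hA : IsPreAntiFlexible p s)
    (r : A ⊗[F] A) (hsymm : (TensorProduct.comm F A A) r = r)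
    (hybe : IsPAFYBESolution p s r) :
    IsPreAntiFlexible
      ((Module.Dual.transpose (R := F) ∘ₗ s ∘ₗ rMapL r).flip)
      (Module.Dual.transpose (R := F) ∘ₗ p.flip ∘ₗ rMapL r) := by
  have hmul := rMapL_dual_mul_of_symm_PAFYBE hsymm hybe
  simp only [Module.Dual.transpose_apply] at hmul
  obtain ⟨h₁, h₂⟩ := hA
  refine ⟨fun a b c => LinearMap.ext fun x => ?_, fun a b c => LinearMap.ext fun x => ?_⟩
  · have h := congrArg b (h₁ (rMapL r c) x (rMapL r a))
    simpa [Module.Dual.transpose_apply] using h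
  · have h := congrArg c (h₂ (rMapL r b) (rMapL r a) x)
    simp only [map_sub] at h
    simp only [LinearMap.comp_apply, LinearMap.flip_apply, LinearMap.sub_apply,
      Module.Dual.transpose_apply, hmul a b, hmul b a]
    linear_combination h
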